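/- Let A ∈ ℂ^{M×M} be a fixed matrix and let x ∈ ℂ^{M} be a random vector whose entries are i.i.d. CN(0,1). Then E{ | x^T A x |² } = Tr( A A^H ) + Tr( A A^* ), where x^T A x = Σ_{m,m'} a_{m m'} x_m x_{m'}. -/

import Mathlib

open MeasureTheory ProbabilityTheory Matrix Filter

/-- Matrices inherit the (pi) measurable structure of functions. -/
instance matrixMeasurableSpace {m n α : Type*} [MeasurableSpace α] :
    MeasurableSpace (Matrix m n α) :=
  inferInstanceAs (MeasurableSpace (m → n → α))

/-- The circularly-symmetric complex Gaussian distribution `CN(0, v)`: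
real and imaginary parts are independent real Gaussians, each of variance `v/2`. -/
noncomputable def complexGaussian (v : ℝ) : Measure ℂ :=
  Measure.map (fun p : ℝ × ℝ => ⟨p.1, p.2⟩)
    ((gaussianReal 0 (v / 2).toNNReal).prod (gaussianReal 0 (v / 2).toNNReal))


lemma qf_integrable_pow (v : NNReal) (n : ℕ) :
    Integrable (fun t : ℝ => t ^ n) (gaussianReal 0 v) := by
  have h := integrable_pow_of_mem_interior_integrableExpSet (X := fun x : ℝ => x)
    (μ := gaussianReal 0 v) (by simp) n
  exact h

lemma qf_deriv_step (p q : ℝ → ℝ)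
    (hp : ∀ t, HasDerivAt p (q t - p t * (t / 2)) t) :
    deriv (fun t => p t * Real.exp (t ^ 2 / 4)) = fun t => q t * Real.exp (t ^ 2 / 4) := by
  ext t
  have h1 : HasDerivAt (fun t : ℝ => t ^ 2 / 4) (t / 2) t := by
    refine ((hasDerivAt_pow 2 t).div_const 4).congr_deriv ?_
    norm_num
    ring
  have := (hp t).mul h1.exp
  refine HasDerivAt.deriv (this.congr_deriv ?_)
  ring

/-- Low moments of the real Gaussian of variance one half. -/
noncomputable def qfm : ℕ → ℝ
  | 0 => 1
  | 2 => 1 / 2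
  | 4 => 3 / 4
  | _ => 0

lemma qf_moment (n : ℕ) (hn : n ≤ 4) :
    ∫ t, t ^ n ∂(gaussianReal 0 ((1 : ℝ) / 2).toNNReal) = qfm n := by
  have h := iteratedDeriv_mgf_zero (X := fun x : ℝ => x)
    (μ := gaussianReal 0 ((1 : ℝ) / 2).toNNReal) (by simp) n
  have h' : ∫ t, t ^ n ∂(gaussianReal 0 ((1 : ℝ) / 2).toNNReal)
      = iteratedDeriv n (fun t : ℝ => 1 * Real.exp (t ^ 2 / 4)) 0 := by
    rw [mgf_fun_id_gaussianReal] at h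
    have e : (fun t : ℝ => Real.exp (0 * t + (((1 : ℝ) / 2).toNNReal : ℝ) * t ^ 2 / 2))
        = fun t : ℝ => 1 * Real.exp (t ^ 2 / 4) := by
      ext t
      rw [Real.coe_toNNReal _ (by norm_num), one_mul]
      congr 1
      ring
    rw [e] at h
    rw [h]
    rfl
  rw [h']
  have s1 := qf_deriv_step (fun _ => 1) (fun t => t / 2) (fun t => by
    refine (hasDerivAt_const t (1 : ℝ)).congr_deriv ?_; ring)
  have s2 := qf_deriv_step (fun t => t / 2) (fun t => 1 / 2 + t ^ 2 / 4) (fun t => by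
    refine ((hasDerivAt_id t).div_const 2).congr_deriv ?_; ring)
  have s3 := qf_deriv_step (fun t => 1 / 2 + t ^ 2 / 4) (fun t => 3 * t / 4 + t ^ 3 / 8)
    (fun t => by
      refine (((hasDerivAt_pow 2 t).div_const 4).const_add (1 / 2)).congr_deriv ?_; norm_num; ring)
  have s4 := qf_deriv_step (fun t => 3 * t / 4 + t ^ 3 / 8)
    (fun t => 3 / 4 + 3 * t ^ 2 / 4 + t ^ 4 / 16)
    (fun t => by
      refine ((((hasDerivAt_id t).const_mul 3).div_const 4).add
        ((hasDerivAt_pow 3 t).div_const 8)).congr_deriv ?_; norm_num; ring)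
  interval_cases n
  · simp [qfm]
  · rw [iteratedDeriv_one, s1]; simp [qfm]
  · rw [iteratedDeriv_succ', iteratedDeriv_one, s1, s2]; simp [qfm]
  · rw [iteratedDeriv_succ', iteratedDeriv_succ', iteratedDeriv_one, s1, s2, s3]; simp [qfm]
  · rw [iteratedDeriv_succ', iteratedDeriv_succ', iteratedDeriv_succ', iteratedDeriv_one,
      s1, s2, s3, s4]; simp [qfm]

lemma qf_expand (a b : ℕ) (p : ℝ × ℝ) :
    (⟨p.1, p.2⟩ : ℂ) ^ a * (star (⟨p.1, p.2⟩ : ℂ)) ^ b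
    = ∑ s ∈ Finset.range (a + 1), ∑ t ∈ Finset.range (b + 1),
      ((Complex.I ^ (a - s) * (-Complex.I) ^ (b - t) * (a.choose s) * (b.choose t)) *
        (((p.1 ^ (s + t) : ℝ) : ℂ) * ((p.2 ^ (a - s + (b - t)) : ℝ) : ℂ))) := by
  have h1 : (⟨p.1, p.2⟩ : ℂ) = p.1 + Complex.I * p.2 := by
    apply Complex.ext <;> simp
  have h2 : star (⟨p.1, p.2⟩ : ℂ) = p.1 + (-Complex.I) * p.2 := by
    apply Complex.ext <;> simp
  rw [h2, h1, add_pow, add_pow, Finset.sum_mul_sum]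
  refine Finset.sum_congr rfl fun s _ => Finset.sum_congr rfl fun t _ => ?_
  push_cast
  rw [mul_pow, mul_pow, pow_add, pow_add]
  ring

lemma qf_meas_mk : Measurable (fun p : ℝ × ℝ => (⟨p.1, p.2⟩ : ℂ)) :=
  Complex.measurableEquivRealProd.symm.measurable

lemma qf_int_term (v : NNReal) (c : ℂ) (k l : ℕ) :
    Integrable (fun p : ℝ × ℝ => c * (((p.1 ^ k : ℝ) : ℂ) * ((p.2 ^ l : ℝ) : ℂ)))
      ((gaussianReal 0 v).prod (gaussianReal 0 v)) :=
  (Integrable.mul_prod (qf_integrable_pow v k).ofReal (qf_integrable_pow v l).ofReal).const_mul c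

lemma qf_int_complex (a b : ℕ) :
    Integrable (fun z : ℂ => z ^ a * (star z) ^ b) (complexGaussian 1) := by
  unfold complexGaussian
  rw [integrable_map_measure (by fun_prop) qf_meas_mk.aemeasurable]
  simp only [Function.comp_def]
  simp_rw [qf_expand]
  exact integrable_finsetSum _ fun s _ => integrable_finsetSum _ fun t _ => qf_int_term _ _ _ _

lemma qf_moment_complex (a b : ℕ) (ha : a ≤ 2) (hb : b ≤ 2) :
    ∫ z : ℂ, z ^ a * (star z) ^ b ∂(complexGaussian 1)
      = if a = b then (a.factorial : ℂ) else 0 := by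
  unfold complexGaussian
  rw [integral_map qf_meas_mk.aemeasurable (by fun_prop)]
  simp_rw [qf_expand]
  have key : ∀ s ∈ Finset.range (a + 1), ∀ t ∈ Finset.range (b + 1),
      ∫ p : ℝ × ℝ, ((Complex.I ^ (a - s) * (-Complex.I) ^ (b - t) * (a.choose s) * (b.choose t)) *
        (((p.1 ^ (s + t) : ℝ) : ℂ) * ((p.2 ^ (a - s + (b - t)) : ℝ) : ℂ)))
        ∂((gaussianReal 0 ((1 : ℝ) / 2).toNNReal).prod (gaussianReal 0 ((1 : ℝ) / 2).toNNReal))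
      = (Complex.I ^ (a - s) * (-Complex.I) ^ (b - t) * (a.choose s) * (b.choose t)) *
        ((qfm (s + t) : ℂ) * (qfm (a - s + (b - t)) : ℂ)) := by
    intro s hs t ht
    rw [Finset.mem_range] at hs ht
    rw [integral_const_mul, integral_prod_mul (fun x : ℝ => ((x ^ (s + t) : ℝ) : ℂ))
      (fun x : ℝ => ((x ^ (a - s + (b - t)) : ℝ) : ℂ)), integral_complex_ofReal,
      integral_complex_ofReal, qf_moment _ (by omega), qf_moment _ (by omega)]
  rw [integral_finsetSum _ fun s _ => integrable_finsetSum _ fun t _ => qf_int_term _ _ _ _]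
  have key2 := Finset.sum_congr (rfl : Finset.range (a + 1) = _) fun s hs =>
    (integral_finsetSum (Finset.range (b + 1)) fun t _ => qf_int_term ((1 : ℝ) / 2).toNNReal
      (Complex.I ^ (a - s) * (-Complex.I) ^ (b - t) * (a.choose s) * (b.choose t))
      (s + t) (a - s + (b - t))).trans
    (Finset.sum_congr rfl fun t ht => key s hs t ht)
  rw [key2]
  interval_cases a <;> interval_cases b <;>
    simp [Finset.sum_range_succ, qfm, Nat.choose, Nat.factorial] <;> norm_num

/-- The indicator multiplicity of `m` in the pair `(i, j)`. -/
def qfc {M : ℕ} (i j m : Fin M) : ℕ := (if i = m then 1 else 0) + (if j = m then 1 else 0)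

lemma qf_prod_pow {M : ℕ} (i j : Fin M) (y : Fin M → ℂ) :
    ∏ m, y m ^ qfc i j m = y i * y j := by
  simp only [qfc, pow_add, Finset.prod_mul_distrib, pow_ite, pow_one, pow_zero]
  simp

lemma qf_comb {M : ℕ} (i j k l : Fin M) :
    ∏ m, (if qfc i j m = qfc k l m then ((qfc i j m).factorial : ℂ) else 0)
      = (if i = k ∧ j = l then 1 else 0) + (if i = l ∧ j = k then 1 else 0) := by
  have hfac : ∏ m, ((qfc i j m).factorial : ℂ) = if i = j then 2 else 1 := by
    by_cases h : i = j
    · subst h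
      rw [Finset.prod_eq_single i]
      · simp [qfc]
      · intro b _ hb; simp [qfc, hb.symm]
      · simp
    · rw [if_neg h]
      refine Finset.prod_eq_one fun m _ => ?_
      by_cases h1 : i = m
      · have : j ≠ m := fun h2 => h (h1.trans h2.symm)
        simp [qfc, h1, this]
      · by_cases h2 : j = m <;> simp [qfc, h1, h2]
  by_cases hall : ∀ m, qfc i j m = qfc k l m
  · rw [Finset.prod_congr rfl fun m _ => if_pos (hall m), hfac]
    have hi := hall i
    have hj := hall j
    simp only [qfc] at hi hj
    grind
  · push Not at hall
    obtain ⟨m, hm⟩ := hall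
    rw [Finset.prod_eq_zero (Finset.mem_univ m) (if_neg hm)]
    have h1 : ¬ (i = k ∧ j = l) := by rintro ⟨rfl, rfl⟩; exact hm rfl
    have h2 : ¬ (i = l ∧ j = k) := by
      rintro ⟨rfl, rfl⟩; exact hm (by simp [qfc, add_comm])
    simp [h1, h2]

lemma qf_c_le {M : ℕ} (i j m : Fin M) : qfc i j m ≤ 2 := by
  unfold qfc; split_ifs <;> omega

lemma qf_rw {M : ℕ} (i j k l : Fin M) (y : Fin M → ℂ) :
    y i * y j * (star (y k) * star (y l))
      = ∏ m, (y m ^ qfc i j m * (star (y m)) ^ qfc k l m) := by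
  rw [Finset.prod_mul_distrib, qf_prod_pow, qf_prod_pow k l (fun m => star (y m))]

theorem stmt_2
    {Ω : Type*} [MeasurableSpace Ω] (μ : Measure Ω) [IsProbabilityMeasure μ]
    (M : ℕ) (A : Matrix (Fin M) (Fin M) ℂ)
    (x : Ω → Fin M → ℂ) (hx : Measurable x)
    (hindep : iIndepFun (fun m ω => x ω m) μ)
    (hdist : ∀ m, μ.map (fun ω => x ω m) = complexGaussian 1) :
    (↑(∫ ω, ‖x ω ⬝ᵥ A.mulVec (x ω)‖ ^ 2 ∂μ) : ℂ)
      = Matrix.trace (A * Aᴴ) + Matrix.trace (A * A.map star) := by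
  have hxm : ∀ m, AEMeasurable (fun ω => x ω m) μ := fun m =>
    ((measurable_pi_apply m).comp hx).aemeasurable
  have hint : ∀ i j k l, Integrable
      (fun ω => x ω i * x ω j * (star (x ω k) * star (x ω l))) μ := by
    intro i j k l
    simp_rw [qf_rw]
    have hpi := hindep.map_fun_eq_pi_map hxm
    have h1 : Integrable (fun y : Fin M → ℂ =>
        ∏ m, (y m ^ qfc i j m * (star (y m)) ^ qfc k l m)) (μ.map (fun ω m => x ω m)) := by
      rw [hpi]
      have : ∀ m, IsProbabilityMeasure (μ.map (fun ω => x ω m)) :=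
        fun m => Measure.isProbabilityMeasure_map (hxm m)
      refine Integrable.fintype_prod_dep
        (f := fun m (z : ℂ) => z ^ qfc i j m * (star z) ^ qfc k l m) fun m => ?_
      rw [hdist m]
      exact qf_int_complex _ _
    exact h1.comp_measurable hx
  have hval : ∀ i j k l, ∫ ω, x ω i * x ω j * (star (x ω k) * star (x ω l)) ∂μ
      = (if i = k ∧ j = l then 1 else 0) + (if i = l ∧ j = k then 1 else 0) := by
    intro i j k l
    simp_rw [qf_rw]
    rw [hindep.integral_fun_prod_comp (𝕜 := ℂ)
      (f := fun m (z : ℂ) => z ^ qfc i j m * (star z) ^ qfc k l m) hxm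
      (fun m => by fun_prop), ← qf_comb]
    refine Finset.prod_congr rfl fun m _ => ?_
    rw [← qf_moment_complex _ _ (qf_c_le i j m) (qf_c_le k l m), ← hdist m,
      integral_map (hxm m) (by fun_prop)]
  have hexp : ∀ ω, (((‖x ω ⬝ᵥ A.mulVec (x ω)‖ ^ 2 : ℝ)) : ℂ)
      = ∑ i, ∑ j, ∑ k, ∑ l, (A i j * star (A k l)) *
          (x ω i * x ω j * (star (x ω k) * star (x ω l))) := by
    intro ω
    have hq : x ω ⬝ᵥ A.mulVec (x ω) = ∑ i, ∑ j, A i j * (x ω i * x ω j) := by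
      simp only [dotProduct, Matrix.mulVec, Finset.mul_sum]
      refine Finset.sum_congr rfl fun i _ => Finset.sum_congr rfl fun j _ => ?_
      ring
    have hn : (((‖x ω ⬝ᵥ A.mulVec (x ω)‖ ^ 2 : ℝ)) : ℂ)
        = (x ω ⬝ᵥ A.mulVec (x ω)) * star (x ω ⬝ᵥ A.mulVec (x ω)) := by
      push_cast
      exact (Complex.mul_conj' _).symm
    rw [hn, hq, mul_comm]
    simp only [star_sum, star_mul', Finset.sum_mul, Finset.mul_sum]
    refine Finset.sum_congr rfl fun i _ => Finset.sum_congr rfl fun j _ =>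
      Finset.sum_congr rfl fun k _ => Finset.sum_congr rfl fun l _ => ?_
    ring
  rw [← integral_complex_ofReal]
  simp_rw [hexp]
  have hI : ∀ i j k l, Integrable (fun ω => (A i j * star (A k l)) *
          (x ω i * x ω j * (star (x ω k) * star (x ω l)))) μ :=
    fun i j k l => (hint i j k l).const_mul _
  have hI1 : ∀ i j k, Integrable (fun ω => ∑ l, (A i j * star (A k l)) *
          (x ω i * x ω j * (star (x ω k) * star (x ω l)))) μ :=
    fun i j k => integrable_finsetSum _ fun l _ => hI i j k l
  have hI2 : ∀ i j, Integrable (fun ω => ∑ k, ∑ l, (A i j * star (A k l)) *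
          (x ω i * x ω j * (star (x ω k) * star (x ω l)))) μ :=
    fun i j => integrable_finsetSum _ fun k _ => hI1 i j k
  have hI3 : ∀ i, Integrable (fun ω => ∑ j, ∑ k, ∑ l, (A i j * star (A k l)) *
          (x ω i * x ω j * (star (x ω k) * star (x ω l)))) μ :=
    fun i => integrable_finsetSum _ fun j _ => hI2 i j
  rw [integral_finsetSum _ fun i _ => hI3 i]
  have hterm : ∀ i j, ∫ ω, ∑ k, ∑ l, (A i j * star (A k l)) *
          (x ω i * x ω j * (star (x ω k) * star (x ω l))) ∂μ
      = A i j * star (A i j) + A i j * star (A j i) := by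
    intro i j
    rw [integral_finsetSum _ fun k _ => hI1 i j k]
    simp_rw [fun k => integral_finsetSum Finset.univ fun l _ => hI i j k l,
      integral_const_mul, hval, mul_add, Finset.sum_add_distrib]
    congr 1
    · simp [ite_and]
    · rw [Finset.sum_comm]; simp [ite_and]
  have hrow : ∀ i, ∫ ω, ∑ j, ∑ k, ∑ l, (A i j * star (A k l)) *
          (x ω i * x ω j * (star (x ω k) * star (x ω l))) ∂μ
      = ∑ j, (A i j * star (A i j) + A i j * star (A j i)) := by
    intro i
    rw [integral_finsetSum _ fun j _ => hI2 i j]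
    exact Finset.sum_congr rfl fun j _ => hterm i j
  rw [Finset.sum_congr rfl fun i _ => hrow i]
  simp [Matrix.trace, Matrix.mul_apply, Finset.sum_add_distrib]
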